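/- arXiv:2505.24058 — 9 statements merged into one kernel-verified Lean document; each statement's English description precedes it below -/
import Mathlib

section
/- Let F, u, v ∈ ℝ with u + v > 0. Set {c} := (u+v)/2 and β̃ := |F|/{c}. Then the modified DDG flux term satisfies the upwind identity {c}·(F + (β̃/2)·(u − v)) = max(F,0)·u + min(F,0)·v = ((F+|F|)/2)·u + ((F−|F|)/2)·v. In particular, F + β̃·{c} ≥ 0 and −F + β̃·{c} ≥ 0. -/
/-- The modified DDG flux with `β̃ = |F|/{c}` is an upwind flux:
`{c}·(F + (β̃/2)(u−v)) = max(F,0)·u + min(F,0)·v = ((F+|F|)/2)·u + ((F−|F|)/2)·v`,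
and `F + β̃{c} ≥ 0`, `−F + β̃{c} ≥ 0`. -/
theorem modified_flux_upwind (F u v : ℝ) (h : 0 < u + v) :
    ((u + v) / 2) * (F + ((|F| / ((u + v) / 2)) / 2) * (u - v))
        = max F 0 * u + min F 0 * v
    ∧ ((u + v) / 2) * (F + ((|F| / ((u + v) / 2)) / 2) * (u - v))
        = ((F + |F|) / 2) * u + ((F - |F|) / 2) * v
    ∧ 0 ≤ F + (|F| / ((u + v) / 2)) * ((u + v) / 2)
    ∧ 0 ≤ -F + (|F| / ((u + v) / 2)) * ((u + v) / 2) := by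
  have hc : (u + v) / 2 ≠ 0 := by positivity
  have hb : (|F| / ((u + v) / 2)) * ((u + v) / 2) = |F| := div_mul_cancel₀ _ hc
  have h2 : ((u + v) / 2) * (F + ((|F| / ((u + v) / 2)) / 2) * (u - v))
      = ((F + |F|) / 2) * u + ((F - |F|) / 2) * v := by
    linear_combination ((u - v) / 2) * hb
  refine ⟨?_, h2, ?_, ?_⟩
  · rw [h2]
    rcases le_total 0 F with hF | hF
    · rw [abs_of_nonneg hF, max_eq_left hF, min_eq_right hF]; ring
    · rw [abs_of_nonpos hF, max_eq_right hF, min_eq_left hF]; ring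
  · rw [hb]; linarith [neg_abs_le F]
  · rw [hb]; linarith [le_abs_self F]
end

section
/- Fix k ∈ ℕ and M ≥ 2. Let a < b, Δx := b − a, and let a = x_1 < x_2 < ⋯ < x_M = b be nodes with weights ω_1, …, ω_M, all positive, with ω_1 = ω_M, such that Σ_{m=1}^M ω_m q(x_m) = (1/Δx) ∫_a^b q(x) dx for every real polynomial q of degree at most k. Let c be a real polynomial of degree at most k, let c_L, c_R, F_L, F_R, Δt ∈ ℝ, and assume {c}_L := (c_L + c(a))/2 > 0 and {c}_R := (c(b) + c_R)/2 > 0. Set β̃_L := |F_L|/{c}_L, β̃_R := |F_R|/{c}_R, G_L := {c}_L·(F_L + (β̃_L/2)·(c(a) − c_L)), and G_R := {c}_R·(F_R + (β̃_R/2)·(c_R − c(b))). Then the following decomposition identity holds: (1/Δx)∫_a^b c + (Δt/Δx)·(G_R − G_L) = Σ_{m=2}^{M−1} ω_m c(x_m) + (ω_1 − (Δt/(2Δx))·(F_L + |F_L|))·c(a) + (ω_M − (Δt/(2Δx))·(|F_R| − F_R))·c(b) + (Δt/(2Δx))·(F_R + |F_R|)·c_R + (Δt/(2Δx))·(|F_L|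 − F_L)·c_L. -/
/-- The quadrature decomposition identity behind Theorem 3.2 (positivity of cell
averages for the hybrid DDG scheme): the updated cell average equals a combination
of interior quadrature values and interface trace terms. -/
theorem cell_average_decomposition
    (k M : ℕ) (hM : 2 ≤ M) (a b : ℝ) (hab : a < b)
    (x ω : ℕ → ℝ)
    (hxa : x 1 = a) (hxb : x M = b)
    (hmono : StrictMonoOn x (Set.Icc 1 M))
    (hωpos : ∀ m ∈ Finset.Icc 1 M, 0 < ω m)
    (hωsym : ω 1 = ω M)
    (hexact : ∀ q : Polynomial ℝ, q.natDegree ≤ k →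
      ∑ m ∈ Finset.Icc 1 M, ω m * q.eval (x m)
        = (1 / (b - a)) * ∫ t in a..b, q.eval t)
    (c : Polynomial ℝ) (hc : c.natDegree ≤ k)
    (cL cR FL FR Δt : ℝ)
    (hL : 0 < (cL + c.eval a) / 2) (hR : 0 < (c.eval b + cR) / 2) :
    (1 / (b - a)) * (∫ t in a..b, c.eval t)
      + (Δt / (b - a)) *
        ( ((c.eval b + cR) / 2) *
            (FR + ((|FR| / ((c.eval b + cR) / 2)) / 2) * (cR - c.eval b))
        - ((cL + c.eval a) / 2) *
            (FL + ((|FL| / ((cL + c.eval a) / 2)) / 2) * (c.eval a - cL)) )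
    = (∑ m ∈ Finset.Icc 2 (M - 1), ω m * c.eval (x m))
      + (ω 1 - (Δt / (2 * (b - a))) * (FL + |FL|)) * c.eval a
      + (ω M - (Δt / (2 * (b - a))) * (|FR| - FR)) * c.eval b
      + (Δt / (2 * (b - a))) * (FR + |FR|) * cR
      + (Δt / (2 * (b - a))) * (|FL| - FL) * cL := by
  have hsum : ∑ m ∈ Finset.Icc 1 M, ω m * c.eval (x m)
      = (∑ m ∈ Finset.Icc 2 (M - 1), ω m * c.eval (x m))
        + ω 1 * c.eval a + ω M * c.eval b := by
    obtain ⟨n, rfl⟩ : ∃ n, M = n + 2 := ⟨M - 2, by omega⟩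
    have h1 : Finset.Icc 1 (n + 2) = insert 1 (insert (n + 2) (Finset.Icc 2 (n + 2 - 1))) := by
      ext m
      simp only [Finset.mem_Icc, Finset.mem_insert]
      omega
    rw [h1, Finset.sum_insert, Finset.sum_insert, hxa, hxb]
    · ring
    · simp only [Finset.mem_Icc]
      omega
    · simp only [Finset.mem_Icc, Finset.mem_insert]
      omega
  rw [← hexact c hc, hsum]
  have key : ∀ A F J : ℝ, 0 < A → A * (F + ((|F| / A) / 2) * J) = A * F + |F| / 2 * J := by
    intro A F J hA
    have : A ≠ 0 := hA.ne'
    field_simp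
  rw [key _ _ _ hL, key _ _ _ hR]
  have hd : b - a ≠ 0 := (sub_pos.mpr hab).ne'
  have h2 : Δt / (2 * (b - a)) = Δt / (b - a) / 2 := by
    field_simp
  rw [h2]
  ring
end

section
/- Fix k ∈ ℕ and M ≥ 2. Let a < b, Δx := b − a, and let a = x_1 < x_2 < ⋯ < x_M = b be nodes with weights ω_1, …, ω_M, all positive, with ω_1 = ω_M, such that Σ_{m=1}^M ω_m q(x_m) = (1/Δx) ∫_a^b q(x) dx for every real polynomial q of degree at most k. Let c be a real polynomial of degree at most k with c(x) ≥ 0 for all x ∈ [a,b], let c_L ≥ 0, c_R ≥ 0 be exterior trace values, F_L, F_R ∈ ℝ flux values, and Δt ≥ 0 a time step satisfying Δt·|F_L| ≤ ω_1·Δx and Δt·|F_R| ≤ ω_1·Δx. Define {c}_L := (c_L + c(a))/2, {c}_R := (c(b) + c_R)/2, β̃_L := |F_L|/{c}_L, β̃_R := |F_R|/{c}_R (with the convention that division by zero gives zero), G_L := {c}_L·(F_L + (β̃_L/2)·(c(a) − c_L)), G_R := {c}_R·(F_R + (β̃_R/2)·(c_R − c(b))). Then the updated cell average (1/Δx)∫_a^b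 c + (Δt/Δx)·(G_R − G_L) is nonnegative. -/
theorem aux_flux (u v F : ℝ) (hu : 0 ≤ u) (hv : 0 ≤ v) :
    ((u + v) / 2) * (F + ((|F| / ((u + v) / 2)) / 2) * (v - u))
      = F * ((u + v) / 2) + |F| / 2 * (v - u) := by
  rcases (add_nonneg hu hv).eq_or_lt with h | h
  · have h1 : u = 0 := by linarith
    have h2 : v = 0 := by linarith
    subst h1 h2
    simp
  · field_simp

/-- Single-cell form of Theorem 3.2 with non-strict CFL condition: the updated
cell average of the modified DDG scheme is nonnegative. -/
theorem cell_average_nonneg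
    (k M : ℕ) (hM : 2 ≤ M) (a b : ℝ) (hab : a < b)
    (x ω : ℕ → ℝ)
    (hxa : x 1 = a) (hxb : x M = b)
    (hmono : StrictMonoOn x (Set.Icc 1 M))
    (hωpos : ∀ m ∈ Finset.Icc 1 M, 0 < ω m)
    (hωsym : ω 1 = ω M)
    (hexact : ∀ q : Polynomial ℝ, q.natDegree ≤ k →
      ∑ m ∈ Finset.Icc 1 M, ω m * q.eval (x m)
        = (1 / (b - a)) * ∫ t in a..b, q.eval t)
    (c : Polynomial ℝ) (hc : c.natDegree ≤ k)
    (hcpos : ∀ t ∈ Set.Icc a b, 0 ≤ c.eval t)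
    (cL cR : ℝ) (hcL : 0 ≤ cL) (hcR : 0 ≤ cR)
    (FL FR Δt : ℝ) (hΔt : 0 ≤ Δt)
    (hCFL_L : Δt * |FL| ≤ ω 1 * (b - a))
    (hCFL_R : Δt * |FR| ≤ ω 1 * (b - a)) :
    0 ≤ (1 / (b - a)) * (∫ t in a..b, c.eval t)
      + (Δt / (b - a)) *
        ( ((c.eval b + cR) / 2) *
            (FR + ((|FR| / ((c.eval b + cR) / 2)) / 2) * (cR - c.eval b))
        - ((cL + c.eval a) / 2) *
            (FL + ((|FL| / ((cL + c.eval a) / 2)) / 2) * (c.eval a - cL)) ) := by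
  have hM1 : 1 ∈ Finset.Icc 1 M := Finset.mem_Icc.2 ⟨le_refl _, by omega⟩
  have hMM : M ∈ Finset.Icc 1 M := Finset.mem_Icc.2 ⟨by omega, le_refl _⟩
  have hA : 0 ≤ c.eval a := hcpos a ⟨le_refl _, hab.le⟩
  have hB : 0 ≤ c.eval b := hcpos b ⟨hab.le, le_refl _⟩
  have hd : 0 < b - a := sub_pos.2 hab
  have hnn : ∀ m ∈ Finset.Icc 1 M, 0 ≤ ω m * c.eval (x m) := by
    intro m hm
    have hm' := Finset.mem_Icc.1 hm
    refine mul_nonneg (hωpos m hm).le (hcpos _ ⟨?_, ?_⟩)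
    · rw [← hxa]
      exact hmono.monotoneOn ⟨le_refl _, by omega⟩ hm' hm'.1
    · rw [← hxb]
      exact hmono.monotoneOn hm' ⟨by omega, le_refl _⟩ hm'.2
  have hsum : ω 1 * c.eval a + ω 1 * c.eval b
      ≤ ∑ m ∈ Finset.Icc 1 M, ω m * c.eval (x m) := by
    have h := Finset.sum_le_sum_of_subset_of_nonneg
      (s := {1, M}) (t := Finset.Icc 1 M) (f := fun m => ω m * c.eval (x m))
      (by
        intro m hm
        simp only [Finset.mem_insert, Finset.mem_singleton] at hm
        rcases hm with rfl | rfl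
        · exact hM1
        · exact hMM)
      (fun m hm _ => hnn m hm)
    rw [Finset.sum_pair (by omega), hxa, hxb, ← hωsym] at h
    exact h
  rw [← hexact c hc, aux_flux _ _ FR hB hcR, aux_flux _ _ FL hcL hA]
  have hR : -(|FR| * c.eval b) ≤ FR * ((c.eval b + cR) / 2) + |FR| / 2 * (cR - c.eval b) := by
    nlinarith [neg_abs_le FR, le_abs_self FR,
      mul_nonneg (by linarith [neg_abs_le FR] : 0 ≤ FR + |FR|) (add_nonneg hB hcR)]
  have hL : FL * ((cL + c.eval a) / 2) + |FL| / 2 * (c.eval a - cL) ≤ |FL| * c.eval a := by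
    nlinarith [mul_nonneg (by linarith [le_abs_self FL] : 0 ≤ |FL| - FL) (add_nonneg hcL hA)]
  have h1 := mul_le_mul_of_nonneg_left (sub_le_sub hR hL) (div_nonneg hΔt hd.le)
  have h2 : Δt / (b - a) * |FL| ≤ ω 1 := by
    rw [div_mul_eq_mul_div, div_le_iff₀ hd]; exact hCFL_L
  have h3 : Δt / (b - a) * |FR| ≤ ω 1 := by
    rw [div_mul_eq_mul_div, div_le_iff₀ hd]; exact hCFL_R
  have h4 := mul_le_mul_of_nonneg_right h2 hA
  have h5 := mul_le_mul_of_nonneg_right h3 hB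
  linarith
end

section
/- Fix k ∈ ℕ and M ≥ 3. Let a < b, Δx := b − a, and let a = x_1 < x_2 < ⋯ < x_M = b be nodes with weights ω_1, …, ω_M, all positive, with ω_1 = ω_M, such that Σ_{m=1}^M ω_m q(x_m) = (1/Δx) ∫_a^b q(x) dx for every real polynomial q of degree at most k. Let c be a real polynomial of degree at most k with c(x) > 0 for all x ∈ [a,b], let c_L ≥ 0, c_R ≥ 0 be exterior trace values, F_L, F_R ∈ ℝ flux values, and Δt ≥ 0 a time step satisfying Δt·|F_L| ≤ ω_1·Δx and Δt·|F_R| ≤ ω_1·Δx. Define {c}_L := (c_L + c(a))/2, {c}_R := (c(b) + c_R)/2, β̃_L := |F_L|/{c}_L, β̃_R := |F_R|/{c}_R, G_L := {c}_L·(F_L + (β̃_L/2)·(c(a) − c_L)), G_R := {c}_R·(F_R + (β̃_R/2)·(c_R − c(b))). Then the updated cell average (1/Δx)∫_a^b c + (Δt/Δx)·(G_R − G_L) is strictly positive. -/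
/-- Single-cell form of Theorem 3.2 with `M ≥ 3` (at least one interior node) and
strictly positive DG polynomial: the updated cell average is strictly positive
under the non-strict CFL condition. -/
theorem cell_average_pos_interior_node
    (k M : ℕ) (hM : 3 ≤ M) (a b : ℝ) (hab : a < b)
    (x ω : ℕ → ℝ)
    (hxa : x 1 = a) (hxb : x M = b)
    (hmono : StrictMonoOn x (Set.Icc 1 M))
    (hωpos : ∀ m ∈ Finset.Icc 1 M, 0 < ω m)
    (hωsym : ω 1 = ω M)
    (hexact : ∀ q : Polynomial ℝ, q.natDegree ≤ k →
      ∑ m ∈ Finset.Icc 1 M, ω m * q.eval (x m)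
        = (1 / (b - a)) * ∫ t in a..b, q.eval t)
    (c : Polynomial ℝ) (hc : c.natDegree ≤ k)
    (hcpos : ∀ t ∈ Set.Icc a b, 0 < c.eval t)
    (cL cR : ℝ) (hcL : 0 ≤ cL) (hcR : 0 ≤ cR)
    (FL FR Δt : ℝ) (hΔt : 0 ≤ Δt)
    (hCFL_L : Δt * |FL| ≤ ω 1 * (b - a))
    (hCFL_R : Δt * |FR| ≤ ω 1 * (b - a)) :
    0 < (1 / (b - a)) * (∫ t in a..b, c.eval t)
      + (Δt / (b - a)) *
        ( ((c.eval b + cR) / 2) *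
            (FR + ((|FR| / ((c.eval b + cR) / 2)) / 2) * (cR - c.eval b))
        - ((cL + c.eval a) / 2) *
            (FL + ((|FL| / ((cL + c.eval a) / 2)) / 2) * (c.eval a - cL)) ) := by
  have hd : 0 < b - a := sub_pos.2 hab
  have ha := hcpos a ⟨le_rfl, hab.le⟩
  have hb := hcpos b ⟨hab.le, le_rfl⟩
  have hterm : ∀ m ∈ Finset.Icc 1 M, 0 < ω m * c.eval (x m) := by
    intro m hm
    have hm' := Finset.mem_Icc.1 hm
    refine mul_pos (hωpos m hm) (hcpos _ ⟨?_, ?_⟩)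
    · rw [← hxa]
      exact hmono.monotoneOn ⟨le_rfl, by omega⟩ hm' hm'.1
    · rw [← hxb]
      exact hmono.monotoneOn hm' ⟨by omega, le_rfl⟩ hm'.2
  have hsub : ({1, 2, M} : Finset ℕ) ⊆ Finset.Icc 1 M := by
    intro m hm
    simp only [Finset.mem_insert, Finset.mem_singleton] at hm
    rw [Finset.mem_Icc]
    omega
  have hsum := Finset.sum_le_sum_of_subset_of_nonneg hsub
    (f := fun m => ω m * c.eval (x m)) (fun m hm _ => (hterm m hm).le)
  rw [Finset.sum_insert (by simp; omega), Finset.sum_insert (by simp; omega),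
    Finset.sum_singleton] at hsum
  have h2 := hterm 2 (Finset.mem_Icc.2 ⟨by omega, by omega⟩)
  simp only [hxa, hxb, ← hωsym] at hsum
  rw [← hexact c hc]
  have key : ∀ F u v : ℝ, 0 ≤ u → 0 < v →
      -(|F| * v) ≤ ((v + u) / 2) * (F + ((|F| / ((v + u) / 2)) / 2) * (u - v)) := by
    intro F u v hu hv
    have e : ((v + u) / 2) * (F + ((|F| / ((v + u) / 2)) / 2) * (u - v))
        = (v + u) / 2 * F + |F| / 2 * (u - v) := by
      have : v + u ≠ 0 := by positivity
      field_simp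
    rw [e]
    have h1 : 0 ≤ |F| + F := by linarith [neg_abs_le F]
    nlinarith [mul_nonneg h1 hu, mul_nonneg h1 hv.le]
  have kR := key FR cR _ hcR hb
  have kL := key (-FL) cL _ hcL ha
  rw [abs_neg, add_comm (c.eval a) cL] at kL
  set GR := ((c.eval b + cR) / 2) *
            (FR + ((|FR| / ((c.eval b + cR) / 2)) / 2) * (cR - c.eval b)) with hGR
  set gl := ((cL + c.eval a) / 2) *
            (FL + ((|FL| / ((cL + c.eval a) / 2)) / 2) * (c.eval a - cL)) with hGL
  have kL' : -(|FL| * c.eval a) ≤ -gl := by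
    refine kL.trans (le_of_eq ?_)
    rw [hGL]; ring
  have h3 : -(ω 1 * (c.eval a + c.eval b)) ≤ Δt / (b - a) * (GR - gl) := by
    rw [div_mul_eq_mul_div, le_div_iff₀ hd]
    have := mul_le_mul_of_nonneg_left (add_le_add kR kL') hΔt
    have e1 := mul_le_mul_of_nonneg_right hCFL_L ha.le
    have e2 := mul_le_mul_of_nonneg_right hCFL_R hb.le
    linarith
  linarith
end

section
/- Fix k ∈ ℕ and M ≥ 2. Let a < b, Δx := b − a, and let a = x_1 < x_2 < ⋯ < x_M = b be nodes with weights ω_1, …, ω_M, all positive, with ω_1 = ω_M, such that Σ_{m=1}^M ω_m q(x_m) = (1/Δx) ∫_a^b q(x) dx for every real polynomial q of degree at most k. Let c be a real polynomial of degree at most k with c(x) > 0 for all x ∈ [a,b], let c_L ≥ 0, c_R ≥ 0 be exterior trace values, F_L, F_R ∈ ℝ flux values, and Δt ≥ 0 a time step satisfying the strict CFL conditions Δt·|F_L| < ω_1·Δx and Δt·|F_R| < ω_1·Δx. Define {c}_L := (c_L + c(a))/2, {c}_R := (c(b) + c_R)/2, β̃_L := |F_L|/{c}_L, β̃_R :=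 |F_R|/{c}_R, G_L := {c}_L·(F_L + (β̃_L/2)·(c(a) − c_L)), G_R := {c}_R·(F_R + (β̃_R/2)·(c_R − c(b))). Then the updated cell average (1/Δx)∫_a^b c + (Δt/Δx)·(G_R − G_L) is strictly positive. -/
/-- Single-cell form of Theorem 3.2 with a strict CFL condition: the updated
cell average is strictly positive for any `M ≥ 2`. -/
theorem cell_average_pos_strict_CFL
    (k M : ℕ) (hM : 2 ≤ M) (a b : ℝ) (hab : a < b)
    (x ω : ℕ → ℝ)
    (hxa : x 1 = a) (hxb : x M = b)
    (hmono : StrictMonoOn x (Set.Icc 1 M))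
    (hωpos : ∀ m ∈ Finset.Icc 1 M, 0 < ω m)
    (hωsym : ω 1 = ω M)
    (hexact : ∀ q : Polynomial ℝ, q.natDegree ≤ k →
      ∑ m ∈ Finset.Icc 1 M, ω m * q.eval (x m)
        = (1 / (b - a)) * ∫ t in a..b, q.eval t)
    (c : Polynomial ℝ) (hc : c.natDegree ≤ k)
    (hcpos : ∀ t ∈ Set.Icc a b, 0 < c.eval t)
    (cL cR : ℝ) (hcL : 0 ≤ cL) (hcR : 0 ≤ cR)
    (FL FR Δt : ℝ) (hΔt : 0 ≤ Δt)
    (hCFL_L : Δt * |FL| < ω 1 * (b - a))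
    (hCFL_R : Δt * |FR| < ω 1 * (b - a)) :
    0 < (1 / (b - a)) * (∫ t in a..b, c.eval t)
      + (Δt / (b - a)) *
        ( ((c.eval b + cR) / 2) *
            (FR + ((|FR| / ((c.eval b + cR) / 2)) / 2) * (cR - c.eval b))
        - ((cL + c.eval a) / 2) *
            (FL + ((|FL| / ((cL + c.eval a) / 2)) / 2) * (c.eval a - cL)) ) := by
  have hd : 0 < b - a := sub_pos.mpr hab
  have ha : 0 < c.eval a := hcpos a ⟨le_rfl, hab.le⟩
  have hb : 0 < c.eval b := hcpos b ⟨hab.le, le_rfl⟩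
  have hsum : ω 1 * c.eval a + ω 1 * c.eval b
      ≤ ∑ m ∈ Finset.Icc 1 M, ω m * c.eval (x m) := by
    have hsub : ({1, M} : Finset ℕ) ⊆ Finset.Icc 1 M := by
      intro m hm
      simp only [Finset.mem_insert, Finset.mem_singleton] at hm
      rw [Finset.mem_Icc]
      omega
    have h := Finset.sum_le_sum_of_subset_of_nonneg
      (f := fun m => ω m * c.eval (x m)) hsub (by
        intro m hm _
        have hm' := Finset.mem_Icc.mp hm
        have h1 : x 1 ≤ x m := hmono.monotoneOn ⟨le_rfl, by omega⟩ hm' hm'.1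
        have h2 : x m ≤ x M := hmono.monotoneOn hm' ⟨by omega, le_rfl⟩ hm'.2
        exact (mul_pos (hωpos m hm) (hcpos _ ⟨hxa ▸ h1, hxb ▸ h2⟩)).le)
    rw [Finset.sum_pair (by omega : (1 : ℕ) ≠ M), hxa, hxb, ← hωsym] at h
    exact h
  rw [← hexact c hc]
  have hR : -(|FR| * c.eval b) ≤ ((c.eval b + cR) / 2) *
      (FR + ((|FR| / ((c.eval b + cR) / 2)) / 2) * (cR - c.eval b)) := by
    have hne : c.eval b + cR ≠ 0 := by positivity
    have e : ((c.eval b + cR) / 2) *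
      (FR + ((|FR| / ((c.eval b + cR) / 2)) / 2) * (cR - c.eval b))
      = (c.eval b + cR) / 2 * FR + |FR| / 2 * (cR - c.eval b) := by
      field_simp
    rw [e]
    have := mul_nonneg (add_nonneg hb.le hcR) (by linarith [neg_abs_le FR] : 0 ≤ FR + |FR|)
    linarith
  have hL : ((cL + c.eval a) / 2) *
      (FL + ((|FL| / ((cL + c.eval a) / 2)) / 2) * (c.eval a - cL)) ≤ |FL| * c.eval a := by
    have hne : cL + c.eval a ≠ 0 := by positivity
    have e : ((cL + c.eval a) / 2) *
      (FL + ((|FL| / ((cL + c.eval a) / 2)) / 2) * (c.eval a - cL))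
      = (cL + c.eval a) / 2 * FL + |FL| / 2 * (c.eval a - cL) := by
      field_simp
    rw [e]
    have := mul_nonneg (add_nonneg hcL ha.le) (by linarith [le_abs_self FL] : 0 ≤ |FL| - FL)
    linarith
  have hG := mul_le_mul_of_nonneg_left (sub_le_sub hR hL) (div_nonneg hΔt hd.le)
  have key : 0 < ω 1 * c.eval a + ω 1 * c.eval b
      + Δt / (b - a) * (-(|FR| * c.eval b) - |FL| * c.eval a) := by
    have e : ω 1 * c.eval a + ω 1 * c.eval b
      + Δt / (b - a) * (-(|FR| * c.eval b) - |FL| * c.eval a)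
      = ((ω 1 * (b - a) - Δt * |FL|) * c.eval a
        + (ω 1 * (b - a) - Δt * |FR|) * c.eval b) / (b - a) := by
      field_simp
      ring
    rw [e]
    exact div_pos (add_pos (mul_pos (sub_pos.mpr hCFL_L) ha)
      (mul_pos (sub_pos.mpr hCFL_R) hb)) hd
  linarith
end

section
/- Fix k ∈ ℕ and M ≥ 2, and let 0 = s_1 < s_2 < ⋯ < s_M = 1 be nodes with weights ω_1, …, ω_M, all positive, with ω_1 = ω_M, such that Σ_{m=1}^M ω_m q(s_m) = ∫_0^1 q(s) ds for every real polynomial q of degree at most k. Let N ≥ 1 and let t_0 < t_1 < ⋯ < t_N be a grid with cells I_j := [t_j, t_{j+1}] and sizes Δx_j := t_{j+1} − t_j for j = 0, …, N−1. For each j let c_j be a real polynomial of degree at most k with c_j(x) > 0 for all x ∈ I_j. Let F_0, …, F_N ∈ ℝ be interface flux values with F_0 = F_N = 0 (zero-flux boundary condition). For each interior interface j = 1, …, N−1, set v_j := c_{j−1}(t_j), u_j := c_j(t_j), {c}_j := (u_j + v_j)/2, β̃_j := |F_j|/{c}_j, and G_j := {c}_j·(F_j + (β̃_j/2)·(u_j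 − v_j)); set G_0 := 0 and G_N := 0. Let Δt ≥ 0 satisfy, for every j = 0, …, N−1, the strict CFL conditions Δt·|F_j| < ω_1·Δx_j and Δt·|F_{j+1}| < ω_1·Δx_j. Then for every j = 0, …, N−1, the updated cell average c̄_j' := (1/Δx_j)∫_{I_j} c_j + (Δt/Δx_j)·(G_{j+1} − G_j) is strictly positive. -/
/-- Theorem 3.2 of the paper: positivity propagation of cell averages for the
positivity-preserving hybrid DDG scheme with forward Euler time stepping and
zero-flux boundary conditions, under a strict CFL condition. -/
theorem positivity_propagation_cell_averages
    (k M : ℕ) (hM : 2 ≤ M)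
    (s ω : ℕ → ℝ)
    (hs1 : s 1 = 0) (hsM : s M = 1)
    (hsmono : StrictMonoOn s (Set.Icc 1 M))
    (hωpos : ∀ m ∈ Finset.Icc 1 M, 0 < ω m)
    (hωsym : ω 1 = ω M)
    (hexact : ∀ q : Polynomial ℝ, q.natDegree ≤ k →
      ∑ m ∈ Finset.Icc 1 M, ω m * q.eval (s m)
        = ∫ u in (0:ℝ)..1, q.eval u)
    (N : ℕ) (hN : 1 ≤ N)
    (t : ℕ → ℝ) (ht : ∀ j < N, t j < t (j + 1))
    (c : ℕ → Polynomial ℝ)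
    (hdeg : ∀ j < N, (c j).natDegree ≤ k)
    (hcpos : ∀ j < N, ∀ x ∈ Set.Icc (t j) (t (j + 1)), 0 < (c j).eval x)
    (F : ℕ → ℝ) (hF0 : F 0 = 0) (hFN : F N = 0)
    (G : ℕ → ℝ) (hG0 : G 0 = 0) (hGN : G N = 0)
    (hG : ∀ j, 1 ≤ j → j < N →
      G j = (((c j).eval (t j) + (c (j - 1)).eval (t j)) / 2) *
        (F j + ((|F j| / (((c j).eval (t j) + (c (j - 1)).eval (t j)) / 2)) / 2) *
          ((c j).eval (t j) - (c (j - 1)).eval (t j))))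
    (Δt : ℝ) (hΔt : 0 ≤ Δt)
    (hCFL : ∀ j < N, Δt * |F j| < ω 1 * (t (j + 1) - t j)
                   ∧ Δt * |F (j + 1)| < ω 1 * (t (j + 1) - t j)) :
    ∀ j < N,
      0 < (1 / (t (j + 1) - t j)) * (∫ x in (t j)..(t (j + 1)), (c j).eval x)
          + (Δt / (t (j + 1) - t j)) * (G (j + 1) - G j) := by
  intro j hj
  have hh : 0 < t (j + 1) - t j := sub_pos.2 (ht j hj)
  set h := t (j + 1) - t j with hdef
  have hu : 0 < (c j).eval (t j) := hcpos j hj _ ⟨le_refl _, (ht j hj).le⟩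
  have hv : 0 < (c j).eval (t (j + 1)) := hcpos j hj _ ⟨(ht j hj).le, le_refl _⟩
  -- quadrature lower bound
  have hq : ω 1 * (c j).eval (t j) + ω 1 * (c j).eval (t (j + 1))
      ≤ (1 / h) * ∫ x in (t j)..(t (j + 1)), (c j).eval x := by
    have hdq : ((c j).comp (Polynomial.C h * Polynomial.X + Polynomial.C (t j))).natDegree ≤ k := by
      refine Polynomial.natDegree_comp_le.trans ?_
      calc _ ≤ (c j).natDegree * 1 := Nat.mul_le_mul_left _ Polynomial.natDegree_linear_le
        _ ≤ k := by simpa using hdeg j hj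
    have e := hexact _ hdq
    simp only [Polynomial.eval_comp, Polynomial.eval_add, Polynomial.eval_mul,
      Polynomial.eval_C, Polynomial.eval_X] at e
    rw [intervalIntegral.integral_comp_mul_add (fun x => (c j).eval x) hh.ne' (t j)] at e
    have e1 : h * 0 + t j = t j := by ring
    have e2 : h * 1 + t j = t (j + 1) := by rw [hdef]; ring
    rw [e1, e2, smul_eq_mul] at e
    rw [one_div, ← e]
    have hsub : ({1, M} : Finset ℕ) ⊆ Finset.Icc 1 M := by
      intro m hm
      simp only [Finset.mem_insert, Finset.mem_singleton] at hm
      rw [Finset.mem_Icc]; omega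
    have hle := Finset.sum_le_sum_of_subset_of_nonneg
      (f := fun m => ω m * (c j).eval (h * s m + t j)) hsub (by
        intro m hm _
        refine mul_nonneg (hωpos m hm).le (hcpos j hj _ ?_).le
        rw [Finset.mem_Icc] at hm
        have a1 : s 1 ≤ s m := hsmono.monotoneOn ⟨le_refl _, by omega⟩ hm hm.1
        have a2 : s m ≤ s M := hsmono.monotoneOn hm ⟨by omega, le_refl _⟩ hm.2
        rw [hs1] at a1; rw [hsM] at a2
        constructor <;> nlinarith)
    rw [Finset.sum_pair (by omega)] at hle
    simp only [hs1, hsM, e1, e2, ← hωsym] at hle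
    exact hle
  -- general form of the flux
  have key : ∀ u v f : ℝ, 0 < u → 0 < v →
      -(|f| * v) ≤ ((u + v) / 2) * (f + ((|f| / ((u + v) / 2)) / 2) * (u - v)) ∧
      ((u + v) / 2) * (f + ((|f| / ((u + v) / 2)) / 2) * (u - v)) ≤ |f| * u := by
    intro u v f hu hv
    have e : ((u + v) / 2) * (f + ((|f| / ((u + v) / 2)) / 2) * (u - v))
        = u * (f + |f|) / 2 + v * (f - |f|) / 2 := by
      have : u + v ≠ 0 := by positivity
      field_simp
      ring
    rw [e]
    have h1 := neg_abs_le f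
    have h2 := le_abs_self f
    constructor <;> nlinarith [mul_nonneg hu.le (by linarith : 0 ≤ f + |f|),
      mul_nonneg hv.le (by linarith : 0 ≤ f + |f|), mul_nonneg hv.le (sub_nonneg.2 h2),
      mul_nonneg hu.le (sub_nonneg.2 h2)]
  have hGl : G j ≤ |F j| * (c j).eval (t j) := by
    rcases Nat.eq_zero_or_pos j with h0 | h0
    · rw [h0, hG0, hF0]; simp
    · rw [hG j h0 hj]
      refine (key _ _ _ hu ?_).2
      have e : j - 1 + 1 = j := by omega
      refine hcpos (j - 1) (by omega) _ ?_
      have := ht (j - 1) (by omega)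
      rw [e] at this ⊢
      exact ⟨this.le, le_refl _⟩
  have hGr : -(|F (j + 1)| * (c j).eval (t (j + 1))) ≤ G (j + 1) := by
    rcases Nat.lt_or_ge (j + 1) N with h0 | h0
    · rw [hG (j + 1) (by omega) h0, Nat.add_sub_cancel]
      exact (key _ _ _ (hcpos (j + 1) h0 _ ⟨le_refl _, (ht _ h0).le⟩) hv).1
    · have : j + 1 = N := by omega
      rw [this, hGN, hFN]; simp
  obtain ⟨c1, c2⟩ := hCFL j hj
  rw [← hdef] at c1 c2
  have f1 := mul_lt_mul_of_pos_right c1 hu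
  have f2 := mul_lt_mul_of_pos_right c2 hv
  have f3 := mul_le_mul_of_nonneg_left (add_le_add hGr (neg_le_neg hGl)) hΔt
  have f4 : -(ω 1 * (c j).eval (t j) + ω 1 * (c j).eval (t (j + 1)))
      < Δt / h * (G (j + 1) - G j) := by
    rw [div_mul_eq_mul_div, lt_div_iff₀ hh]
    nlinarith
  linarith
end

section
/- Let a < b and let f : ℝ → ℝ be continuous on [a,b], with cell average f̄ := (1/(b−a)) ∫_a^b f(x) dx and minimum m := min_{x∈[a,b]} f(x). Let δ ∈ ℝ satisfy m < δ < f̄, and define the reconstructed function f^δ(x) := f̄ + ((f̄ − δ)/(f̄ − m))·(f(x) − f̄). Then: (a) (1/(b−a)) ∫_a^b f^δ(x) dx = f̄ (the cell average is preserved); (b) f^δ(x) ≥ δ for all x ∈ [a,b], and min_{x∈[a,b]} f^δ(x) = δ; (c) for all x ∈ [a,b], |f^δ(x) − f(x)| = ((δ − m)/(f̄ − m))·|f(x) − f̄|. -/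
/-- Properties of the positivity-preserving reconstruction (limiter) of Section 3.2:
(a) the cell average is preserved; (b) the limited function stays above `δ`, with
minimum exactly `δ`; (c) pointwise deviation formula. -/
theorem limiter_properties
    (a b : ℝ) (hab : a < b) (f : ℝ → ℝ)
    (hf : ContinuousOn f (Set.Icc a b))
    (fbar m : ℝ)
    (hfbar : fbar = (1 / (b - a)) * ∫ x in a..b, f x)
    (hm : IsLeast (f '' Set.Icc a b) m)
    (δ : ℝ) (hδ1 : m < δ) (hδ2 : δ < fbar) :
    ((1 / (b - a)) * ∫ x in a..b,
        (fbar + ((fbar - δ) / (fbar - m)) * (f x - fbar)) = fbar)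
    ∧ (∀ x ∈ Set.Icc a b,
        δ ≤ fbar + ((fbar - δ) / (fbar - m)) * (f x - fbar))
    ∧ IsLeast ((fun x => fbar + ((fbar - δ) / (fbar - m)) * (f x - fbar)) ''
        Set.Icc a b) δ
    ∧ (∀ x ∈ Set.Icc a b,
        |(fbar + ((fbar - δ) / (fbar - m)) * (f x - fbar)) - f x|
          = ((δ - m) / (fbar - m)) * |f x - fbar|) := by
  have hd : 0 < fbar - m := by linarith
  have hba : b - a ≠ 0 := by
    have : 0 < b - a := by linarith
    exact this.ne'
  have hfi : IntervalIntegrable f MeasureTheory.volume a b :=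
    ContinuousOn.intervalIntegrable_of_Icc hab.le hf
  have hI : ∫ x in a..b, f x = (b - a) * fbar := by
    rw [hfbar]; field_simp
  have hc : (fbar - δ) / (fbar - m) * (m - fbar) = δ - fbar := by
    field_simp; ring
  have hcpos : 0 ≤ (fbar - δ) / (fbar - m) := div_nonneg (by linarith) hd.le
  have hlow : ∀ x ∈ Set.Icc a b,
      δ ≤ fbar + ((fbar - δ) / (fbar - m)) * (f x - fbar) := by
    intro x hx
    have h1 : m ≤ f x := hm.2 ⟨x, hx, rfl⟩
    have h2 := mul_le_mul_of_nonneg_left (sub_le_sub_right h1 fbar) hcpos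
    linarith
  refine ⟨?_, hlow, ⟨?_, ?_⟩, ?_⟩
  · rw [intervalIntegral.integral_add intervalIntegrable_const
      ((hfi.sub intervalIntegrable_const).const_mul _),
      intervalIntegral.integral_const_mul,
      intervalIntegral.integral_sub hfi intervalIntegrable_const, hI]
    simp only [intervalIntegral.integral_const, smul_eq_mul, sub_self, mul_zero, add_zero]
    field_simp
  · obtain ⟨x, hx, hxm⟩ := hm.1
    refine ⟨x, hx, ?_⟩
    simp only [hxm, hc]
    ring
  · rintro _ ⟨x, hx, rfl⟩
    exact hlow x hx
  · intro x _
    have h : fbar + ((fbar - δ) / (fbar - m)) * (f x - fbar) - f x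
        = -(((δ - m) / (fbar - m)) * (f x - fbar)) := by
      field_simp; ring
    rw [h, abs_neg, abs_mul, abs_of_nonneg (div_nonneg (by linarith) hd.le)]
end

section
/- For every k ∈ ℕ there exists a constant C(k) ≥ 0 such that for all reals a < b and every real polynomial p of degree at most k, setting p̄ := (1/(b−a)) ∫_a^b p(x) dx, one has max_{x∈[a,b]} |p(x) − p̄| ≤ C(k)·(p̄ − min_{x∈[a,b]} p(x)). -/
open Polynomial in
lemma aux_inj (n : ℕ) (c : Fin n → ℝ)
    (h : ∀ j : Fin n, ∫ t in (0:ℝ)..1, t ^ (j:ℕ) * ∑ i, c i * t ^ (i:ℕ) = 0) : c = 0 := by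
  set q : ℝ[X] := ∑ i, Polynomial.C (c i) * Polynomial.X ^ (i:ℕ) with hq
  have hev : ∀ t, q.eval t = ∑ i, c i * t ^ (i:ℕ) := by
    intro t; simp [hq, Polynomial.eval_finsetSum]
  have hint : ∫ t in (0:ℝ)..1, (q.eval t) ^ 2 = 0 := by
    have : ∀ t, (q.eval t)^2 = ∑ j, c j * (t ^ (j:ℕ) * ∑ i, c i * t ^ (i:ℕ)) := by
      intro t
      rw [← hev, sq]
      nth_rewrite 1 [hev]
      rw [Finset.sum_mul]
      exact Finset.sum_congr rfl fun _ _ => by ring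
    simp_rw [this]
    rw [intervalIntegral.integral_finsetSum]
    · simp [h]
    · intro i _
      apply Continuous.intervalIntegrable
      fun_prop
  have hz : ∀ t ∈ Set.Icc (0:ℝ) 1, q.eval t = 0 := by
    by_contra! hc
    obtain ⟨t, ht, hne⟩ := hc
    have := intervalIntegral.integral_pos (f := fun t => (q.eval t)^2) (zero_lt_one' ℝ)
      (by fun_prop) (fun x _ => sq_nonneg _) ⟨t, ht, by positivity⟩
    linarith
  have hq0 : q = 0 := Polynomial.eq_zero_of_infinite_isRoot q
    ((Set.Icc_infinite (zero_lt_one' ℝ)).mono fun t ht => hz t ht)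
  funext i
  have := congrArg (fun p => p.coeff (i:ℕ)) hq0
  simpa [hq, Polynomial.finsetSum_coeff, Polynomial.coeff_X_pow, Fin.val_inj] using this

lemma aux_unit (n : ℕ) : ∃ K : ℝ, 0 ≤ K ∧ ∀ c : Fin n → ℝ,
    (∀ t ∈ Set.Icc (0:ℝ) 1, 0 ≤ ∑ i, c i * t ^ (i:ℕ)) →
    ∀ x ∈ Set.Icc (0:ℝ) 1, ∑ i, c i * x ^ (i:ℕ) ≤
      K * ∫ t in (0:ℝ)..1, ∑ i, c i * t ^ (i:ℕ) := by
  have hii : ∀ (c : Fin n → ℝ) (j : ℕ), IntervalIntegrable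
      (fun t : ℝ => t ^ j * ∑ i, c i * t ^ (i:ℕ)) MeasureTheory.volume 0 1 := by
    intro c j
    apply Continuous.intervalIntegrable
    fun_prop
  let T : (Fin n → ℝ) →ₗ[ℝ] (Fin n → ℝ) :=
    { toFun := fun c j => ∫ t in (0:ℝ)..1, t ^ (j:ℕ) * ∑ i, c i * t ^ (i:ℕ)
      map_add' := by
        intro c d
        funext j
        simp only [Pi.add_apply]
        rw [← intervalIntegral.integral_add (hii c j) (hii d j)]
        congr 1
        funext t
        simp only [add_mul, Finset.sum_add_distrib, mul_add]
      map_smul' := by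
        intro r c
        funext j
        simp only [Pi.smul_apply, smul_eq_mul, RingHom.id_apply]
        rw [← intervalIntegral.integral_const_mul]
        congr 1
        funext t
        simp only [mul_assoc, ← Finset.mul_sum]
        ring }
  have hker : Function.Injective T := by
    rw [← LinearMap.ker_eq_bot, LinearMap.ker_eq_bot']
    intro c hc
    exact aux_inj n c fun j => congrFun hc j
  obtain ⟨K, -, hK⟩ := (LinearMap.injective_iff_antilipschitz T).1 hker
  refine ⟨n * K, by positivity, ?_⟩
  intro c hc x hx
  set I := ∫ t in (0:ℝ)..1, ∑ i, c i * t ^ (i:ℕ) with hI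
  have hi0 := hii c 0
  simp only [pow_zero, one_mul] at hi0
  have hI0 : 0 ≤ I := intervalIntegral.integral_nonneg zero_le_one hc
  have hT : ‖T c‖ ≤ I := by
    rw [pi_norm_le_iff_of_nonneg hI0]
    intro j
    have h0 : 0 ≤ T c j := intervalIntegral.integral_nonneg zero_le_one fun t ht =>
      mul_nonneg (pow_nonneg ht.1 _) (hc t ht)
    rw [Real.norm_of_nonneg h0]
    apply intervalIntegral.integral_mono_on zero_le_one (hii c j) hi0
    intro t ht
    exact mul_le_of_le_one_left (hc t ht) (pow_le_one₀ ht.1 ht.2)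
  have hcn : ‖c‖ ≤ K * I := by
    have := hK.le_mul_dist c 0
    simp only [map_zero, dist_zero_right] at this
    exact this.trans (by gcongr)
  calc ∑ i, c i * x ^ (i:ℕ) ≤ ∑ i : Fin n, K * I := by
        apply Finset.sum_le_sum
        intro i _
        have h1 : c i ≤ ‖c‖ := (le_abs_self _).trans (norm_le_pi_norm c i)
        have h2 : x ^ (i:ℕ) ≤ 1 := pow_le_one₀ hx.1 hx.2
        have h3 : 0 ≤ x ^ (i:ℕ) := pow_nonneg hx.1 _
        nlinarith [norm_nonneg c]
    _ = n * K * I := by simp; ring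


/-- Inverse-type inequality for polynomials of degree at most `k` on an interval:
the sup-norm deviation from the cell average is controlled, with a constant
depending only on `k`, by the deviation of the cell average from the minimum. -/
theorem polynomial_inverse_inequality (k : ℕ) :
    ∃ C : ℝ, 0 ≤ C ∧
      ∀ (a b : ℝ), a < b → ∀ p : Polynomial ℝ, p.natDegree ≤ k →
        ∀ m : ℝ, IsLeast ((fun x => p.eval x) '' Set.Icc a b) m →
          ∀ x ∈ Set.Icc a b,
            |p.eval x - (1 / (b - a)) * ∫ t in a..b, p.eval t|
              ≤ C * ((1 / (b - a)) * (∫ t in a..b, p.eval t) - m) := by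
  obtain ⟨K, hK0, hK⟩ := aux_unit (k+1)
  refine ⟨K + 1, by positivity, ?_⟩
  intro a b hab p hp m hm x hx
  have hba : 0 < b - a := sub_pos.2 hab
  set r : Polynomial ℝ := (p - Polynomial.C m).comp
    (Polynomial.C (b - a) * Polynomial.X + Polynomial.C a) with hr
  have hrd : r.natDegree < k + 1 := by
    have h1 : (p - Polynomial.C m).natDegree ≤ k := by
      rw [Polynomial.natDegree_sub_C]; exact hp
    have h2 : (Polynomial.C (b - a) * Polynomial.X + Polynomial.C a).natDegree ≤ 1 :=
      Polynomial.natDegree_linear_le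
    have h3 := Polynomial.natDegree_comp_le (p := p - Polynomial.C m)
      (q := Polynomial.C (b - a) * Polynomial.X + Polynomial.C a)
    have h4 := Nat.mul_le_mul h1 h2
    rw [← hr] at h3
    omega
  have hre : ∀ t, r.eval t = p.eval ((b - a) * t + a) - m := by
    intro t; simp [hr, Polynomial.eval_comp]
  have hrs : ∀ t, ∑ i : Fin (k+1), r.coeff (i:ℕ) * t ^ (i:ℕ) = p.eval ((b - a) * t + a) - m := by
    intro t
    rw [← hre, Polynomial.eval_eq_sum_range' hrd, Finset.sum_range]
  have hge : ∀ y ∈ Set.Icc a b, m ≤ p.eval y := fun y hy => hm.2 ⟨y, hy, rfl⟩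
  have key := hK (fun i => r.coeff (i:ℕ))
  simp only [hrs] at key
  have hint : ∫ t in (0:ℝ)..1, (p.eval ((b - a) * t + a) - m)
      = 1 / (b - a) * (∫ t in a..b, p.eval t) - m := by
    rw [intervalIntegral.integral_sub, intervalIntegral.integral_comp_mul_add (fun t => p.eval t) hba.ne']
    · simp
    · apply Continuous.intervalIntegrable
      fun_prop
    · simp
  rw [hint] at key
  have hnn : 0 ≤ 1 / (b - a) * (∫ t in a..b, p.eval t) - m := by
    rw [← hint]
    apply intervalIntegral.integral_nonneg zero_le_one
    intro t ht
    exact sub_nonneg.2 (hge _ ⟨by nlinarith [ht.1], by nlinarith [ht.2]⟩)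
  have hx' := key (fun t ht => sub_nonneg.2 (hge _ ⟨by nlinarith [ht.1], by nlinarith [ht.2]⟩))
    ((x - a) / (b - a)) ⟨div_nonneg (sub_nonneg.2 hx.1) hba.le,
      (div_le_one hba).2 (by linarith [hx.2])⟩
  rw [mul_div_cancel₀ _ hba.ne', sub_add_cancel] at hx'
  have hx0 := hge x hx
  have := mul_nonneg hK0 hnn
  rw [abs_le]
  constructor <;> linarith
end

section
/- For every k ∈ ℕ there exists a constant C(k) ≥ 0 such that the following holds. Let a < b, let p be a real polynomial of degree at most k with cell average p̄ := (1/(b−a)) ∫_a^b p(x) dx and minimum m := min_{x∈[a,b]} p(x), let w : ℝ → ℝ be continuous on [a,b] with w(x) ≥ 0 for all x ∈ [a,b], and let δ ≥ 0 satisfy p̄ > δ. Define the limited polynomial p^δ by p^δ(x) := p̄ + ((p̄ − δ)/(p̄ − m))·(p(x) − p̄) if m < δ, and p^δ := p otherwise. Then for all x ∈ [a,b], |p^δ(x) − p(x)| ≤ C(k)·( max_{y∈[a,b]} |p(y) − w(y)| + δ ). -/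
lemma limiter_aux_pos (k : ℕ) (c : Fin (k+1) → ℝ) (hc : c ≠ 0) :
    0 < ∫ t in (0:ℝ)..1, |∑ i, c i * t ^ (i:ℕ)| := by
  have hcont : Continuous fun t : ℝ => |∑ i, c i * t ^ (i:ℕ)| := by fun_prop
  by_contra hneg
  apply hc
  have hz : ∀ t ∈ Set.Icc (0:ℝ) 1, ∑ i, c i * t ^ (i:ℕ) = 0 := by
    intro t ht
    by_contra hne
    apply hneg
    apply intervalIntegral.integral_pos (by norm_num) hcont.continuousOn
    · intro x _; exact abs_nonneg _
    · exact ⟨t, ht, abs_pos.mpr hne⟩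
  set P : Polynomial ℝ := ∑ i : Fin (k+1), Polynomial.C (c i) * Polynomial.X ^ (i:ℕ) with hP
  have hP0 : P = 0 := by
    apply Polynomial.eq_zero_of_infinite_isRoot
    apply (Set.Icc_infinite (show (0:ℝ) < 1 by norm_num)).mono
    intro t ht
    have := hz t ht
    simpa [hP, Polynomial.IsRoot, Polynomial.eval_finset_sum] using this
  funext j
  have h1 : P.coeff j = c j := by
    simp only [hP, Polynomial.finset_sum_coeff, Polynomial.coeff_C_mul_X_pow]
    simp [Fin.val_inj]
  rw [← h1, hP0]; simp

lemma limiter_aux_norm (k : ℕ) : ∃ K : ℝ, 0 ≤ K ∧ ∀ q : Polynomial ℝ, q.natDegree ≤ k →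
    ∀ x ∈ Set.Icc (0:ℝ) 1, |q.eval x| ≤ K * ∫ t in (0:ℝ)..1, |q.eval t| := by
  let I : (Fin (k+1) → ℝ) → ℝ := fun c => ∫ t in (0:ℝ)..1, |∑ i, c i * t ^ (i:ℕ)|
  have hI : Continuous I := by
    apply intervalIntegral.continuous_parametric_intervalIntegral_of_continuous'
    simp only [Function.uncurry_def]
    fun_prop
  obtain ⟨c0, hc0, hmin⟩ := (isCompact_sphere (0 : Fin (k+1) → ℝ) 1).exists_isMinOn
    (NormedSpace.sphere_nonempty.mpr zero_le_one) hI.continuousOn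
  have hc0n : c0 ≠ 0 := by
    rintro rfl
    simp at hc0
  have hpos : 0 < I c0 := limiter_aux_pos k c0 hc0n
  have hhom : ∀ c, ‖c‖ * I c0 ≤ I c := by
    intro c
    by_cases hc : c = 0
    · subst hc; simp [I]
    have hn : 0 < ‖c‖ := norm_pos_iff.mpr hc
    have hs : ‖c‖⁻¹ • c ∈ Metric.sphere (0 : Fin (k+1) → ℝ) 1 := by
      simp [norm_smul, hn.ne']
    have h := hmin hs
    have h2 : I (‖c‖⁻¹ • c) = ‖c‖⁻¹ * I c := by
      simp only [I]
      rw [← intervalIntegral.integral_const_mul]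
      congr 1
      funext t
      rw [← abs_of_pos (inv_pos.mpr hn), ← abs_mul, Finset.mul_sum, abs_of_pos (inv_pos.mpr hn)]
      simp [mul_assoc]
    have h3 : I c0 ≤ ‖c‖⁻¹ * I c := h2 ▸ h
    calc ‖c‖ * I c0 ≤ ‖c‖ * (‖c‖⁻¹ * I c) := by gcongr
      _ = I c := by field_simp
  refine ⟨(k+1) / I c0, by positivity, ?_⟩
  intro q hq x hx
  have hev : ∀ t, q.eval t = ∑ i : Fin (k+1), q.coeff i * t ^ (i:ℕ) := by
    intro t
    rw [Polynomial.eval_eq_sum_range' (Nat.lt_succ_of_le hq), Finset.sum_range]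
  let c : Fin (k+1) → ℝ := fun i => q.coeff i
  have h1 : (∫ t in (0:ℝ)..1, |q.eval t|) = I c := by simp only [hev, I, c]
  rw [h1]
  have h2 : |q.eval x| ≤ (k+1) * ‖c‖ := by
    rw [hev]
    calc _ ≤ ∑ i : Fin (k+1), |q.coeff i * x ^ (i:ℕ)| := Finset.abs_sum_le_sum_abs _ _
      _ ≤ ∑ i : Fin (k+1), ‖c‖ := by
        apply Finset.sum_le_sum
        intro i _
        rw [abs_mul, abs_of_nonneg (pow_nonneg hx.1 _)]
        have := norm_le_pi_norm c i
        have h3 : x ^ (i:ℕ) ≤ 1 := pow_le_one₀ hx.1 hx.2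
        calc _ ≤ |q.coeff i| * 1 := by gcongr
          _ ≤ ‖c‖ := by simpa [c] using this
      _ = _ := by simp
  calc _ ≤ (k+1) * ‖c‖ := h2
    _ = (k+1) / I c0 * (‖c‖ * I c0) := by field_simp
    _ ≤ _ := by gcongr; exact hhom c

lemma limiter_aux_cell (k : ℕ) : ∃ K : ℝ, 0 ≤ K ∧ ∀ a b : ℝ, a < b →
    ∀ q : Polynomial ℝ, q.natDegree ≤ k → (∀ x ∈ Set.Icc a b, 0 ≤ q.eval x) →
    ∀ x ∈ Set.Icc a b, q.eval x ≤ K * ((1 / (b - a)) * ∫ t in a..b, q.eval t) := by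
  obtain ⟨K, hK, h⟩ := limiter_aux_norm k
  refine ⟨K, hK, ?_⟩
  intro a b hab q hq hnn x hx
  have hd : 0 < b - a := sub_pos.mpr hab
  let r : Polynomial ℝ := q.comp (Polynomial.C (b-a) * Polynomial.X + Polynomial.C a)
  have hr : r.natDegree ≤ k := by
    refine Polynomial.natDegree_comp_le.trans ?_
    calc _ ≤ q.natDegree * 1 := Nat.mul_le_mul_left _ Polynomial.natDegree_linear_le
      _ ≤ k := by simpa using hq
  have hre : ∀ t, r.eval t = q.eval ((b-a)*t+a) := by intro t; simp [r]
  have h1 := h r hr ((x-a)/(b-a))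
    ⟨div_nonneg (by linarith [hx.1]) hd.le, (div_le_one hd).mpr (by linarith [hx.2])⟩
  have h2 : (∫ t in (0:ℝ)..1, |r.eval t|) = (1 / (b - a)) * ∫ t in a..b, q.eval t := by
    have : (∫ t in (0:ℝ)..1, |r.eval t|) = ∫ t in (0:ℝ)..1, q.eval ((b-a)*t+a) := by
      apply intervalIntegral.integral_congr
      intro t ht
      rw [Set.uIcc_of_le zero_le_one] at ht
      simp only [hre]
      apply abs_of_nonneg
      apply hnn
      constructor <;> nlinarith [ht.1, ht.2]
    rw [this, intervalIntegral.integral_comp_mul_add (fun t => q.eval t) hd.ne']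
    simp
  rw [h2, hre, mul_div_cancel₀ _ hd.ne', sub_add_cancel] at h1
  exact (le_abs_self _).trans h1


/-- Accuracy of the positivity-preserving limiter (Lemma 4.2 of Liu–Wang): the
limited polynomial differs from the original by at most `C(k)·(‖p − w‖_∞ + δ)`. -/
theorem limiter_accuracy (k : ℕ) :
    ∃ C : ℝ, 0 ≤ C ∧
      ∀ (a b : ℝ), a < b →
      ∀ p : Polynomial ℝ, p.natDegree ≤ k →
      ∀ pbar m : ℝ,
        pbar = (1 / (b - a)) * ∫ t in a..b, p.eval t →
        IsLeast ((fun x => p.eval x) '' Set.Icc a b) m →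
      ∀ w : ℝ → ℝ, ContinuousOn w (Set.Icc a b) →
        (∀ x ∈ Set.Icc a b, 0 ≤ w x) →
      ∀ δ : ℝ, 0 ≤ δ → δ < pbar →
      ∀ E : ℝ, IsGreatest ((fun y => |p.eval y - w y|) '' Set.Icc a b) E →
      ∀ x ∈ Set.Icc a b,
        |(if m < δ then pbar + ((pbar - δ) / (pbar - m)) * (p.eval x - pbar)
          else p.eval x) - p.eval x|
          ≤ C * (E + δ) := by


  obtain ⟨K, hK, h⟩ := limiter_aux_cell k
  refine ⟨K + 1, by positivity, ?_⟩
  intro a b hab p hp pbar m hpbar hm w _ hw δ hδ hδp E hE x hx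
  obtain ⟨⟨x0, hx0, hx0m⟩, hlb⟩ := hm
  have hmE : -m ≤ E := by
    have h1 := hE.2 ⟨x0, hx0, rfl⟩
    have h2 := hw x0 hx0
    simp only at h1 hx0m
    have := neg_abs_le (p.eval x0 - w x0)
    linarith
  have hE0 : 0 ≤ E := (abs_nonneg _).trans (hE.2 ⟨x0, hx0, rfl⟩)
  split_ifs with hmd
  swap
  · simp only [sub_self, abs_zero]; positivity
  have hd : 0 < b - a := sub_pos.mpr hab
  have hml : ∀ y ∈ Set.Icc a b, m ≤ p.eval y := fun y hy => hlb ⟨y, hy, rfl⟩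
  have h1 := h a b hab (p - Polynomial.C m) (by rw [Polynomial.natDegree_sub_C]; exact hp)
    (fun y hy => by simpa using hml y hy) x hx
  have h2 : (1 / (b - a)) * ∫ t in a..b, (p - Polynomial.C m).eval t = pbar - m := by
    simp only [Polynomial.eval_sub, Polynomial.eval_C]
    rw [intervalIntegral.integral_sub (p.continuous.intervalIntegrable _ _) (by simp), hpbar]
    simp only [intervalIntegral.integral_const, smul_eq_mul]
    field_simp
  rw [h2, Polynomial.eval_sub, Polynomial.eval_C] at h1
  have hpm : 0 < pbar - m := by linarith
  have h3 : |p.eval x - pbar| ≤ (K + 1) * (pbar - m) := by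
    have := hml x hx
    have := mul_nonneg hK hpm.le
    rw [abs_le]; constructor <;> linarith
  have h4 : pbar + ((pbar - δ) / (pbar - m)) * (p.eval x - pbar) - p.eval x
      = -((δ - m) / (pbar - m) * (p.eval x - pbar)) := by
    field_simp; ring
  have h5 : 0 ≤ (δ - m) / (pbar - m) := div_nonneg (by linarith) hpm.le
  rw [h4, abs_neg, abs_mul, abs_of_nonneg h5]
  calc _ ≤ (δ - m) / (pbar - m) * ((K + 1) * (pbar - m)) := by gcongr
    _ = (K + 1) * (δ - m) := by field_simp
    _ ≤ _ := by gcongr; linarith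
end
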